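/- Suppose V̂ satisfies the Bellman equation for π. Then for every action a, the conditional variance of the δHCA estimator decomposes as a sum of per-step variances with no cross terms: Var_π(Â^δHCA_N(a) | S_0 = s) = Var_π((1(A_0=a)/π(a|s))·δ_0 | S_0 = s) + Σ_{k=1}^{N−1} γ^{2k}·Var_π((p_k(a|s,S_k)/π(a|s))·δ_k | S_0 = s). -/

import Mathlib

open Finset

attribute [local instance] Classical.propDecidable

namespace HCA

/-- A trajectory of horizon `N`: the actions taken at steps `0, …, N-1` and the
states reached after each step (the start state is fixed separately). -/
abbrev Traj (S A : Type*) (N : ℕ) : Type _ := (Fin N → A) × (Fin N → S)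

variable {S A : Type*} [Fintype S] [Fintype A] [Nonempty S] [Nonempty A]

/-- The state `S_k` of a trajectory with start state `s`. -/
def st {N : ℕ} (s : S) (τ : Traj S A N) : ℕ → S
  | 0 => s
  | k + 1 => if h : k < N then τ.2 ⟨k, h⟩ else s

/-- The action `A_k` of a trajectory. -/
noncomputable def ac {N : ℕ} (τ : Traj S A N) (k : ℕ) : A :=
  if h : k < N then τ.1 ⟨k, h⟩ else Classical.arbitrary A

/-- The probability `P_π(τ) = ∏_{k=0}^{N-1} π(A_k|S_k)·P(S_{k+1}|S_k,A_k)` of a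
trajectory starting at `s`. -/
noncomputable def trajP (π : S → A → ℝ) (P : S → A → S → ℝ) (s : S) (N : ℕ)
    (τ : Traj S A N) : ℝ :=
  ∏ k : Fin N, π (st s τ k) (τ.1 k) * P (st s τ k) (τ.1 k) (st s τ (k + 1))

/-- Expectation `E_π[f | S_0 = s]` over trajectories. -/
noncomputable def expct (π : S → A → ℝ) (P : S → A → S → ℝ) (s : S) (N : ℕ)
    (f : Traj S A N → ℝ) : ℝ :=
  ∑ τ : Traj S A N, trajP π P s N τ * f τ

/-- Variance `Var_π(f | S_0 = s)` over trajectories. -/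
noncomputable def vr (π : S → A → ℝ) (P : S → A → S → ℝ) (s : S) (N : ℕ)
    (f : Traj S A N → ℝ) : ℝ :=
  expct π P s N (fun τ => (f τ - expct π P s N f) ^ 2)

/-- Covariance `cov_π(f, g | S_0 = s)` over trajectories. -/
noncomputable def cv (π : S → A → ℝ) (P : S → A → S → ℝ) (s : S) (N : ℕ)
    (f g : Traj S A N → ℝ) : ℝ :=
  expct π P s N (fun τ => (f τ - expct π P s N f) * (g τ - expct π P s N g))

/-- Probability `P_π(E | S_0 = s)` of an event `E` on trajectories. -/
noncomputable def prE (π : S → A → ℝ) (P : S → A → S → ℝ) (s : S) (N : ℕ)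
    (E : Traj S A N → Prop) : ℝ :=
  ∑ τ : Traj S A N, if E τ then trajP π P s N τ else 0

/-- The TD error `δ_k = r(S_k,A_k) + γ·V̂(S_{k+1}) − V̂(S_k)`. -/
noncomputable def td (r : S → A → ℝ) (γ : ℝ) (V : S → ℝ) (s : S) {N : ℕ}
    (τ : Traj S A N) (k : ℕ) : ℝ :=
  r (st s τ k) (ac τ k) + γ * V (st s τ (k + 1)) - V (st s τ k)

/-- `p_k(s'|s,a) = P_π(S_k = s' | S_0 = s, A_0 = a)
  = P_π(A_0 = a, S_k = s' | S_0 = s) / π(a|s)`. -/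
noncomputable def pkSA (π : S → A → ℝ) (P : S → A → S → ℝ) (s : S) (N k : ℕ)
    (a : A) (s' : S) : ℝ :=
  prE π P s N (fun τ => ac τ 0 = a ∧ st s τ k = s') / π s a

/-- `p_k(s'|s) = Σ_a π(a|s)·p_k(s'|s,a)`. -/
noncomputable def pkS (π : S → A → ℝ) (P : S → A → S → ℝ) (s : S) (N k : ℕ)
    (s' : S) : ℝ :=
  ∑ a : A, π s a * pkSA π P s N k a s'

/-- The hindsight probability `p_k(a|s,s')`, defined as
`P_π(A_0 = a, S_k = s' | S_0 = s)/p_k(s'|s)` when `p_k(s'|s) > 0` and `0` otherwise. -/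
noncomputable def pkA (π : S → A → ℝ) (P : S → A → S → ℝ) (s : S) (N k : ℕ)
    (a : A) (s' : S) : ℝ :=
  if 0 < pkS π P s N k s' then
    prE π P s N (fun τ => ac τ 0 = a ∧ st s τ k = s') / pkS π P s N k s'
  else 0

/-- The `N`-step Monte-Carlo advantage estimator
`Â^MC_N(a) = (1(A_0=a)/π(a|s))·Σ_{k=0}^{N−1} γ^k·δ_k`. -/
noncomputable def mcEst (π : S → A → ℝ) (r : S → A → ℝ) (γ : ℝ) (V : S → ℝ)
    (s : S) (N : ℕ) (a : A) (τ : Traj S A N) : ℝ :=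
  ((if ac τ 0 = a then (1 : ℝ) else 0) / π s a) * ∑ k ∈ range N, γ ^ k * td r γ V s τ k

/-- The `N`-step δHCA advantage estimator
`Â^δHCA_N(a) = (1(A_0=a)/π(a|s))·δ_0 + Σ_{k=1}^{N−1} γ^k·(p_k(a|s,S_k)/π(a|s))·δ_k`. -/
noncomputable def dhcaEst (π : S → A → ℝ) (P : S → A → S → ℝ) (r : S → A → ℝ)
    (γ : ℝ) (V : S → ℝ) (s : S) (N : ℕ) (a : A) (τ : Traj S A N) : ℝ :=
  ((if ac τ 0 = a then (1 : ℝ) else 0) / π s a) * td r γ V s τ 0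
    + ∑ k ∈ Ico 1 N, γ ^ k * (pkA π P s N k a (st s τ k) / π s a) * td r γ V s τ k

/-- `V` satisfies the Bellman equation for `π`:
`V(s₀) = Σ_a π(a|s₀)·(r(s₀,a) + γ·Σ_{s'} P(s'|s₀,a)·V(s'))` for every state `s₀`. -/
def IsBellman (π : S → A → ℝ) (P : S → A → S → ℝ) (r : S → A → ℝ) (γ : ℝ)
    (V : S → ℝ) : Prop :=
  ∀ s₀ : S, V s₀ = ∑ a : A, π s₀ a * (r s₀ a + γ * ∑ s' : S, P s₀ a s' * V s')

/-- The conditional second moment `E_π[δ_k² | S_0 = s, S_k = s']`,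
defined as `(Σ_{τ : S_k = s'} P_π(τ)·δ_k(τ)²)/p_k(s'|s)`. -/
noncomputable def sndMom (π : S → A → ℝ) (P : S → A → S → ℝ) (r : S → A → ℝ)
    (γ : ℝ) (V : S → ℝ) (s : S) (N k : ℕ) (s' : S) : ℝ :=
  (∑ τ : Traj S A N, if st s τ k = s' then trajP π P s N τ * (td r γ V s τ k) ^ 2 else 0)
    / pkS π P s N k s'

/-- Prepend a first step `(a, s')` to a trajectory. -/
def consT {N : ℕ} (a : A) (s' : S) (τ : Traj S A N) : Traj S A (N + 1) :=
  (Fin.cons a τ.1, Fin.cons s' τ.2)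

/-- `g` depends only on the first `k` steps of the trajectory. -/
def Dep {N : ℕ} (k : ℕ) (g : Traj S A N → ℝ) : Prop :=
  ∀ τ τ' : Traj S A N, (∀ i : Fin N, (i : ℕ) < k → τ.1 i = τ'.1 i ∧ τ.2 i = τ'.2 i) → g τ = g τ'

theorem st_consT {N : ℕ} (s s' : S) (a : A) (τ : Traj S A N) (j : ℕ) (hj : j ≤ N) :
    st s (consT a s' τ) (j + 1) = st s' τ j := by
  cases j with
  | zero => simp [st, consT]
  | succ j =>
    have h : j < N := hj
    have e : (⟨j + 1, by omega⟩ : Fin (N + 1)) = Fin.succ ⟨j, h⟩ := rfl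
    simp only [st, consT, h, dif_pos, Nat.add_lt_add_iff_right, e, Fin.cons_succ]

theorem ac_consT_zero {N : ℕ} (s' : S) (a : A) (τ : Traj S A N) :
    ac (consT a s' τ) 0 = a := by
  simp [ac, consT]

theorem ac_consT {N : ℕ} (s' : S) (a : A) (τ : Traj S A N) (j : ℕ) (hj : j < N) :
    ac (consT a s' τ) (j + 1) = ac τ j := by
  have e : (⟨j + 1, by omega⟩ : Fin (N + 1)) = Fin.succ ⟨j, hj⟩ := rfl
  simp only [ac, consT, hj, dif_pos, Nat.add_lt_add_iff_right, e, Fin.cons_succ]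

theorem td_consT_zero {N : ℕ} (r : S → A → ℝ) (γ : ℝ) (V : S → ℝ) (s s' : S) (a : A)
    (τ : Traj S A N) : td r γ V s (consT a s' τ) 0 = r s a + γ * V s' - V s := by
  simp only [td, ac_consT_zero, st_consT s s' a τ 0 (Nat.zero_le _)]
  simp [st]

theorem td_consT {N : ℕ} (r : S → A → ℝ) (γ : ℝ) (V : S → ℝ) (s s' : S) (a : A)
    (τ : Traj S A N) (k : ℕ) (hk : k < N) :
    td r γ V s (consT a s' τ) (k + 1) = td r γ V s' τ k := by
  simp only [td, ac_consT s' a τ k hk, st_consT s s' a τ k hk.le, st_consT s s' a τ (k + 1) hk]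

theorem trajP_consT {N : ℕ} (π : S → A → ℝ) (P : S → A → S → ℝ) (s s' : S) (a : A)
    (τ : Traj S A N) :
    trajP π P s (N + 1) (consT a s' τ) = π s a * P s a s' * trajP π P s' N τ := by
  unfold trajP
  rw [Fin.prod_univ_succ]
  refine congrArg₂ (· * ·) ?_ ?_
  · have := st_consT s s' a τ 0 (Nat.zero_le _)
    simp only [Fin.val_zero, this]
    simp [st, consT]
  · refine Finset.prod_congr rfl fun k _ => ?_
    have h1 := st_consT s s' a τ k k.2.le
    have h2 := st_consT s s' a τ (k + 1) k.2
    simp only [Fin.val_succ, h1, h2]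
    simp [consT]

theorem expct_succ (π : S → A → ℝ) (P : S → A → S → ℝ) (s : S) (N : ℕ)
    (f : Traj S A (N + 1) → ℝ) :
    expct π P s (N + 1) f
      = ∑ a : A, ∑ s' : S, π s a * P s a s' * expct π P s' N (fun τ => f (consT a s' τ)) := by
  unfold expct
  rw [Fintype.sum_prod_type,
    ← (Fin.consEquiv fun _ : Fin (N + 1) => A).sum_comp, Fintype.sum_prod_type]
  refine Finset.sum_congr rfl fun a _ => ?_
  simp_rw [← (Fin.consEquiv fun _ : Fin (N + 1) => S).sum_comp, Fintype.sum_prod_type]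
  rw [Finset.sum_comm]
  refine Finset.sum_congr rfl fun s' _ => ?_
  simp_rw [Finset.mul_sum]
  refine Finset.sum_congr rfl fun x _ => Finset.sum_congr rfl fun y _ => ?_
  rw [← mul_assoc, ← trajP_consT]
  rfl

theorem expct_const (π : S → A → ℝ) (P : S → A → S → ℝ)
    (hπsum : ∀ s₀ : S, ∑ a : A, π s₀ a = 1)
    (hPsum : ∀ (s₀ : S) (a : A), ∑ s' : S, P s₀ a s' = 1) (c : ℝ) (N : ℕ) (s : S) :
    expct π P s N (fun _ => c) = c := by
  induction N generalizing s with
  | zero => simp [expct, trajP]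
  | succ N ih =>
    rw [expct_succ]
    simp_rw [ih, ← Finset.sum_mul, ← Finset.mul_sum, hPsum, mul_one, hπsum, one_mul]

theorem bellman_zero (π : S → A → ℝ) (P : S → A → S → ℝ) (r : S → A → ℝ) (γ : ℝ)
    (hπsum : ∀ s₀ : S, ∑ a : A, π s₀ a = 1)
    (hPsum : ∀ (s₀ : S) (a : A), ∑ s' : S, P s₀ a s' = 1)
    (V : S → ℝ) (hV : IsBellman π P r γ V) (s : S) :
    ∑ a : A, ∑ s' : S, π s a * P s a s' * (r s a + γ * V s' - V s) = 0 := by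
  have h : ∀ a, ∑ s' : S, π s a * P s a s' * (r s a + γ * V s' - V s)
      = π s a * (r s a + γ * ∑ s' : S, P s a s' * V s') - π s a * V s := by
    intro a
    have : ∀ s', π s a * P s a s' * (r s a + γ * V s' - V s)
      = (π s a * (r s a - V s)) * P s a s' + (π s a * γ) * (P s a s' * V s') := by
      intro s'; ring
    simp_rw [this, Finset.sum_add_distrib, ← Finset.mul_sum, hPsum]
    ring
  simp_rw [h, Finset.sum_sub_distrib, ← Finset.sum_mul, hπsum]
  rw [← hV s]; ring

theorem expct_dep_td (π : S → A → ℝ) (P : S → A → S → ℝ) (r : S → A → ℝ) (γ : ℝ)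
    (hπsum : ∀ s₀ : S, ∑ a : A, π s₀ a = 1)
    (hPsum : ∀ (s₀ : S) (a : A), ∑ s' : S, P s₀ a s' = 1)
    (V : S → ℝ) (hV : IsBellman π P r γ V) (k N : ℕ) (hk : k < N) (s : S)
    (g : Traj S A N → ℝ) (hg : Dep k g) :
    expct π P s N (fun τ => g τ * td r γ V s τ k) = 0 := by
  induction k generalizing N s with
  | zero =>
    obtain ⟨N, rfl⟩ : ∃ M, N = M + 1 := ⟨N - 1, by omega⟩
    have hc : ∃ c, ∀ τ, g τ = c :=
      ⟨g (fun _ => Classical.arbitrary A, fun _ => s),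
        fun τ => hg _ _ fun i hi => absurd hi (Nat.not_lt_zero _)⟩
    obtain ⟨c, hc⟩ := hc
    rw [expct_succ]
    simp_rw [hc, td_consT_zero, expct_const π P hπsum hPsum]
    have := bellman_zero π P r γ hπsum hPsum V hV s
    calc _ = c * ∑ a : A, ∑ s' : S, π s a * P s a s' * (r s a + γ * V s' - V s) := by
          simp_rw [Finset.mul_sum]
          refine Finset.sum_congr rfl fun x _ => Finset.sum_congr rfl fun y _ => ?_
          ring
      _ = 0 := by rw [this, mul_zero]
  | succ k ih =>
    obtain ⟨N, rfl⟩ : ∃ M, N = M + 1 := ⟨N - 1, by omega⟩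
    rw [expct_succ]
    refine Finset.sum_eq_zero fun a _ => Finset.sum_eq_zero fun s' _ => ?_
    have hk' : k < N := by omega
    simp_rw [fun τ => td_consT r γ V s s' a τ k hk']
    rw [ih N hk' s' (fun τ => g (consT a s' τ)), mul_zero]
    intro τ τ' h
    refine hg _ _ fun i hi => ?_
    revert hi
    refine Fin.cases ?_ (fun j => ?_) i
    · intro _; simp [consT]
    · intro hj
      simpa [consT] using h j (by simpa using hj)

theorem st_eq {N : ℕ} (s : S) (τ τ' : Traj S A N) (n k : ℕ) (hk : k ≤ n)
    (h : ∀ i : Fin N, (i : ℕ) < n → τ.1 i = τ'.1 i ∧ τ.2 i = τ'.2 i) :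
    st s τ k = st s τ' k := by
  cases k with
  | zero => rfl
  | succ k =>
    by_cases hN : k < N
    · simp only [st, hN, dif_pos]; exact (h ⟨k, hN⟩ hk).2
    · simp [st, hN]

theorem ac_eq {N : ℕ} (τ τ' : Traj S A N) (n k : ℕ) (hk : k < n)
    (h : ∀ i : Fin N, (i : ℕ) < n → τ.1 i = τ'.1 i ∧ τ.2 i = τ'.2 i) :
    ac τ k = ac τ' k := by
  by_cases hN : k < N
  · simp only [ac, hN, dif_pos]; exact (h ⟨k, hN⟩ hk).1
  · simp [ac, hN]

theorem td_eq {N : ℕ} (r : S → A → ℝ) (γ : ℝ) (V : S → ℝ) (s : S) (τ τ' : Traj S A N)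
    (n k : ℕ) (hk : k < n)
    (h : ∀ i : Fin N, (i : ℕ) < n → τ.1 i = τ'.1 i ∧ τ.2 i = τ'.2 i) :
    td r γ V s τ k = td r γ V s τ' k := by
  simp only [td, ac_eq τ τ' n k hk h, st_eq s τ τ' n k hk.le h, st_eq s τ τ' n (k + 1) hk h]

theorem vr_add (π : S → A → ℝ) (P : S → A → S → ℝ)
    (hπsum : ∀ s₀ : S, ∑ a : A, π s₀ a = 1)
    (hPsum : ∀ (s₀ : S) (a : A), ∑ s' : S, P s₀ a s' = 1) (s : S) (N : ℕ) (c : ℝ)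
    (f g : Traj S A N → ℝ) (hg : expct π P s N g = 0)
    (hfg : expct π P s N (fun τ => f τ * g τ) = 0) :
    vr π P s N (fun τ => f τ + c * g τ) = vr π P s N f + c ^ 2 * vr π P s N g := by
  have hE : expct π P s N (fun τ => f τ + c * g τ) = expct π P s N f := by
    have : expct π P s N (fun τ => f τ + c * g τ)
        = expct π P s N f + c * expct π P s N g := by
      simp only [expct, Finset.mul_sum, ← Finset.sum_add_distrib]
      exact Finset.sum_congr rfl fun _ _ => by ring
    rw [this, hg]; ring
  unfold vr
  rw [hE, hg]
  generalize expct π P s N f = m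
  have : expct π P s N (fun τ => (f τ + c * g τ - m) ^ 2)
      = expct π P s N (fun τ => (f τ - m) ^ 2)
        + c ^ 2 * expct π P s N (fun τ => (g τ - 0) ^ 2)
        + 2 * c * expct π P s N (fun τ => f τ * g τ) - 2 * c * m * expct π P s N g := by
    simp only [expct, Finset.mul_sum, ← Finset.sum_add_distrib, ← Finset.sum_sub_distrib]
    exact Finset.sum_congr rfl fun _ _ => by ring
  rw [this, hfg, hg]; ring

theorem stmt_7 {S A : Type*} [Fintype S] [Fintype A] [Nonempty S] [Nonempty A]
    (π : S → A → ℝ) (P : S → A → S → ℝ) (r : S → A → ℝ) (γ : ℝ)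
    (N : ℕ) (s : S)
    (hπpos : ∀ s₀ a, 0 < π s₀ a) (hπsum : ∀ s₀ : S, ∑ a : A, π s₀ a = 1)
    (hPnn : ∀ s₀ a s', 0 ≤ P s₀ a s') (hPsum : ∀ (s₀ : S) (a : A), ∑ s' : S, P s₀ a s' = 1)
    (hγ0 : 0 ≤ γ) (hγ1 : γ ≤ 1) (hN : 1 ≤ N)
    (V : S → ℝ) (hV : IsBellman π P r γ V) :
    ∀ a : A, vr π P s N (dhcaEst π P r γ V s N a)
      = vr π P s N (fun τ => (if ac τ 0 = a then (1 : ℝ) else 0) / π s a * td r γ V s τ 0)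
        + ∑ k ∈ Ico 1 N, γ ^ (2 * k) *
            vr π P s N (fun τ => pkA π P s N k a (st s τ k) / π s a * td r γ V s τ k) := by
  intro a
  have key : ∀ n, 1 ≤ n → n ≤ N →
      vr π P s N (fun τ => (if ac τ 0 = a then (1 : ℝ) else 0) / π s a * td r γ V s τ 0
        + ∑ k ∈ Ico 1 n, γ ^ k * (pkA π P s N k a (st s τ k) / π s a) * td r γ V s τ k)
      = vr π P s N (fun τ => (if ac τ 0 = a then (1 : ℝ) else 0) / π s a * td r γ V s τ 0)
        + ∑ k ∈ Ico 1 n, γ ^ (2 * k) *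
            vr π P s N (fun τ => pkA π P s N k a (st s τ k) / π s a * td r γ V s τ k) := by
    intro n hn
    induction n, hn using Nat.le_induction with
    | base => intro _; simp
    | succ n hn ih =>
      intro hnN
      have ih := ih (by omega)
      rw [Finset.sum_Ico_succ_top hn, ← add_assoc, ← ih]
      have hp : ∀ τ τ' : Traj S A N,
          (∀ i : Fin N, (i : ℕ) < n → τ.1 i = τ'.1 i ∧ τ.2 i = τ'.2 i) →
          ∀ k, k ≤ n → pkA π P s N k a (st s τ k) / π s a
            = pkA π P s N k a (st s τ' k) / π s a := by
        intro τ τ' h k hk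
        rw [st_eq s τ τ' n k hk h]
      have h0 := expct_dep_td π P r γ hπsum hPsum V hV n N (by omega) s
        (fun τ => pkA π P s N n a (st s τ n) / π s a) (fun τ τ' h => hp τ τ' h n le_rfl)
      have h1 := expct_dep_td π P r γ hπsum hPsum V hV n N (by omega) s
        (fun τ => ((if ac τ 0 = a then (1 : ℝ) else 0) / π s a * td r γ V s τ 0
        + ∑ k ∈ Ico 1 n, γ ^ k * (pkA π P s N k a (st s τ k) / π s a) * td r γ V s τ k)
          * (pkA π P s N n a (st s τ n) / π s a)) (by
          intro τ τ' h
          simp only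
          rw [hp τ τ' h n le_rfl, ac_eq τ τ' n 0 hn h, td_eq r γ V s τ τ' n 0 hn h]
          congr 2
          refine Finset.sum_congr rfl fun k hk => ?_
          have hk' := (Finset.mem_Ico.1 hk).2
          rw [hp τ τ' h k hk'.le, td_eq r γ V s τ τ' n k hk' h])
      have h2 := vr_add π P hπsum hPsum s N (γ ^ n)
        (fun τ => (if ac τ 0 = a then (1 : ℝ) else 0) / π s a * td r γ V s τ 0
        + ∑ k ∈ Ico 1 n, γ ^ k * (pkA π P s N k a (st s τ k) / π s a) * td r γ V s τ k) _ h0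
        (by simp only [mul_assoc] at h1 ⊢; exact h1)
      rw [mul_comm 2 n, pow_mul, ← h2]
      congr 1
      funext τ
      rw [Finset.sum_Ico_succ_top hn]
      ring
  exact key N hN le_rfl

end HCA
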